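/- arXiv:quant-ph/0202054 — 6 statements merged into one kernel-verified Lean document; each statement's English description precedes it below -/
import Mathlib

section
/- Let W be a finite-dimensional complex inner product space, C ⊆ W a linear subspace, and (E_a)_{a∈ι} a finite family of linear operators on W. The following are equivalent: (i) for all a, b ∈ ι the value ⟨ψ, E_a† E_b ψ⟩ is the same for every unit vector ψ ∈ C; (ii) for every orthonormal basis (ψ_j) of C there exist constants c_{ab} ∈ ℂ such that ⟨ψ_j, E_a† E_b ψ_k⟩ = c_{ab} δ_{jk} for all a, b ∈ ι and all j, k. -/
open scoped InnerProductSpace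

section ScalarCompression

variable {W : Type*} [NormedAddCommGroup W] [InnerProductSpace ℂ W]

/-- An operator with constant expectation value on the unit vectors of `C` compresses to a scalar
on `C`. -/
theorem exists_inner_map_eq_mul_inner_of_unit {C : Submodule ℂ W} {T : W →ₗ[ℂ] W}
    (h : ∀ ψ φ : W, ψ ∈ C → ‖ψ‖ = 1 → φ ∈ C → ‖φ‖ = 1 → ⟪ψ, T ψ⟫_ℂ = ⟪φ, T φ⟫_ℂ) :
    ∃ c : ℂ, ∀ x ∈ C, ∀ y ∈ C, ⟪x, T y⟫_ℂ = c * ⟪x, y⟫_ℂ := by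
  obtain ⟨c, hc⟩ : ∃ c : ℂ, ∀ φ ∈ C, ‖φ‖ = 1 → ⟪φ, T φ⟫_ℂ = c := by
    by_cases hu : ∃ ψ ∈ C, ‖ψ‖ = 1
    · obtain ⟨ψ, hψ, hψ1⟩ := hu
      exact ⟨⟪ψ, T ψ⟫_ℂ, fun φ hφ hφ1 => h φ ψ hφ hφ1 hψ hψ1⟩
    · exact ⟨0, fun φ hφ hφ1 => (hu ⟨φ, hφ, hφ1⟩).elim⟩
  have hdiag : ∀ x ∈ C, ⟪(T - c • LinearMap.id : W →ₗ[ℂ] W) x, x⟫_ℂ = 0 := by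
    intro x hx
    rw [inner_eq_zero_symm]
    rcases eq_or_ne x 0 with rfl | hx0
    · simp
    have hn : (‖x‖ : ℂ) ≠ 0 := by exact_mod_cast norm_ne_zero_iff.mpr hx0
    have hunit := hc _ (C.smul_mem (‖x‖ : ℂ)⁻¹ hx) (norm_smul_inv_norm (𝕜 := ℂ) hx0)
    rw [map_smul, inner_smul_left, inner_smul_right, map_inv₀, Complex.conj_ofReal] at hunit
    have hself : ⟪x, x⟫_ℂ = (‖x‖ : ℂ) ^ 2 := inner_self_eq_norm_sq_to_K x
    simp only [LinearMap.sub_apply, LinearMap.smul_apply, LinearMap.id_apply, inner_sub_right,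
      inner_smul_right, hself]
    field_simp at hunit
    linear_combination hunit
  refine ⟨c, fun x hx y hy => ?_⟩
  have hzero : ⟪(T - c • LinearMap.id : W →ₗ[ℂ] W) y, x⟫_ℂ = 0 := by
    have hIy := C.smul_mem Complex.I hy
    rw [inner_map_polarization, hdiag _ (C.add_mem hx hy), hdiag _ (C.sub_mem hx hy),
      hdiag _ (C.add_mem hx hIy), hdiag _ (C.sub_mem hx hIy)]
    simp
  rw [inner_eq_zero_symm] at hzero
  simpa [inner_sub_right, inner_smul_right, sub_eq_zero] using hzero

/-- The relation `⟪x, T y⟫ = c * ⟪x, y⟫` on a subspace can be checked on an orthonormal basis. -/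
theorem OrthonormalBasis.inner_map_eq_mul_inner {C : Submodule ℂ W} {T : W →ₗ[ℂ] W} {J : Type*}
    [Fintype J] [DecidableEq J] (ψ : OrthonormalBasis J ℂ C) {c : ℂ}
    (h : ∀ j k, ⟪(ψ j : W), T (ψ k)⟫_ℂ = c * (if j = k then 1 else 0)) (x y : C) :
    ⟪(x : W), T y⟫_ℂ = c * ⟪(x : W), (y : W)⟫_ℂ := by
  have hinner : ∀ j k, ⟪(ψ j : W), (ψ k : W)⟫_ℂ = if j = k then 1 else 0 := fun j k => by
    rw [← Submodule.coe_inner, orthonormal_iff_ite.mp ψ.orthonormal]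
  rw [← ψ.sum_repr x, ← ψ.sum_repr y]
  simp only [Submodule.coe_sum, Submodule.coe_smul, map_sum, map_smul, sum_inner, inner_sum,
    inner_smul_left, inner_smul_right, h, hinner, Finset.mul_sum]
  refine Finset.sum_congr rfl fun j _ => Finset.sum_congr rfl fun k _ => ?_
  ring

end ScalarCompression

/-- Equivalence of the QEC criterion and the QEC II criterion:
(i) for all a, b the value ⟨ψ, E_a† E_b ψ⟩ is the same for every unit vector ψ ∈ C, iff
(ii) for every orthonormal basis (ψ_j) of C there exist constants c_{ab} with
⟨ψ_j, E_a† E_b ψ_k⟩ = c_{ab} δ_{jk}. -/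
theorem qec_iff_qecII {W : Type*} [NormedAddCommGroup W] [InnerProductSpace ℂ W]
    [FiniteDimensional ℂ W] (C : Submodule ℂ W) {ι : Type*} [Fintype ι]
    (E : ι → W →ₗ[ℂ] W) :
    (∀ a b : ι, ∀ ψ φ : W, ψ ∈ C → ‖ψ‖ = 1 → φ ∈ C → ‖φ‖ = 1 →
        ⟪ψ, (LinearMap.adjoint (E a)) ((E b) ψ)⟫_ℂ
          = ⟪φ, (LinearMap.adjoint (E a)) ((E b) φ)⟫_ℂ)
      ↔
    (∀ (J : Type) [Fintype J] [DecidableEq J] (ψ : OrthonormalBasis J ℂ C),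
      ∃ c : ι → ι → ℂ, ∀ (a b : ι) (j k : J),
        ⟪((ψ j : C) : W), (LinearMap.adjoint (E a)) ((E b) ((ψ k : C) : W))⟫_ℂ
          = c a b * (if j = k then 1 else 0)) := by
  constructor
  · intro h J _ _ ψ
    choose c hc using fun a b => exists_inner_map_eq_mul_inner_of_unit
      (T := LinearMap.adjoint (E a) ∘ₗ E b) (h a b)
    refine ⟨c, fun a b j k => ?_⟩
    rw [← orthonormal_iff_ite.mp ψ.orthonormal j k]
    exact hc a b _ (ψ j).2 _ (ψ k).2
  · intro h a b
    obtain ⟨c, hc⟩ := h _ (stdOrthonormalBasis ℂ C)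
    have hunit : ∀ ψ ∈ C, ‖ψ‖ = 1 →
        ⟪ψ, (LinearMap.adjoint (E a)) ((E b) ψ)⟫_ℂ = c a b := fun ψ hψ hψ1 => by
      have := (stdOrthonormalBasis ℂ C).inner_map_eq_mul_inner
        (T := LinearMap.adjoint (E a) ∘ₗ E b) (hc a b) ⟨ψ, hψ⟩ ⟨ψ, hψ⟩
      simpa [inner_self_eq_norm_sq_to_K, hψ1] using this
    intro ψ φ hψ hψ1 hφ hφ1
    rw [hunit ψ hψ hψ1, hunit φ hφ hφ1]
end

section
/- Let W = ℂ^d with its standard Hermitian inner product, let C ⊆ W be a linear subspace with orthogonal projection π : W → W onto C, and let (E_a)_{a∈ι} be a finite family of linear operators on W satisfying Σ_a E_a† E_a = Id. Then the following are equivalent: (i) there exists a finite family of linear operators (R_b)_{b∈κ} on W with Σ_b R_b† R_b = Id such that Σ_b Σ_a R_b E_a P E_a† R_b† = P for every positive semidefinite operator P of trace 1 satisfying π P π = P; (ii) there exist constants c_{ab} ∈ ℂ such that π E_a† E_b π = c_{ab} π for all a, b ∈ ι. -/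
open Matrix
open scoped ComplexOrder

/-- If a sum of rank-one positive matrices `x j (x j)ᴴ` equals `v vᴴ`, then each `x j` is a
multiple of `v`. -/
lemma exists_eq_smul_of_sum_vecMulVec_eq {n κ : Type*} [Fintype n] [Fintype κ]
    (x : κ → n → ℂ) {v : n → ℂ} (hv : v ≠ 0)
    (h : ∑ j, vecMulVec (x j) (star (x j)) = vecMulVec v (star v)) (j : κ) :
    ∃ c : ℂ, x j = c • v := by
  have hvv : star v ⬝ᵥ v ≠ 0 := fun h0 => hv (dotProduct_star_self_eq_zero.1 h0)
  have key (w : n → ℂ) (hw : star v ⬝ᵥ w = 0) : star (x j) ⬝ᵥ w = 0 := by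
    have h1 := congrArg (fun M : Matrix n n ℂ => star w ⬝ᵥ (M *ᵥ w)) h
    have h2 (y : n → ℂ) : star w ⬝ᵥ (vecMulVec y (star y) *ᵥ w) =
        star (star y ⬝ᵥ w) * (star y ⬝ᵥ w) := by
      rw [vecMulVec_mulVec, ← star_dotProduct, dotProduct_smul]
      rfl
    simp only [sum_mulVec, dotProduct_sum, h2, hw, mul_zero] at h1
    have h3 := (Fintype.sum_eq_zero_iff_of_nonneg fun i => star_mul_self_nonneg _).1 h1
    simpa using congrFun h3 j
  let c := (star v ⬝ᵥ x j) / (star v ⬝ᵥ v)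
  have hw : star v ⬝ᵥ (x j - c • v) = 0 := by
    rw [dotProduct_sub, dotProduct_smul, smul_eq_mul, div_mul_cancel₀ _ hvv, sub_self]
  refine ⟨c, sub_eq_zero.1 (dotProduct_star_self_eq_zero.1 ?_)⟩
  rw [star_sub, sub_dotProduct, key _ hw, star_smul, smul_dotProduct, hw, smul_zero, sub_zero]

/-- A matrix for which every vector fixed by the idempotent `π` is an eigenvector is scalar on the
range of `π`. -/
lemma exists_mul_eq_smul_of_forall_mulVec {n : Type*} [Fintype n] {π A : Matrix n n ℂ}
    (hπ : π * π = π) (h : ∀ v : n → ℂ, v ≠ 0 → π *ᵥ v = v → ∃ c : ℂ, A *ᵥ v = c • v) :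
    ∃ c : ℂ, A * π = c • π := by
  classical
  have fixed (u : n → ℂ) : π *ᵥ (π *ᵥ u) = π *ᵥ u := by rw [mulVec_mulVec, hπ]
  by_cases h0 : π = 0
  · exact ⟨0, by simp [h0]⟩
  obtain ⟨u, hu⟩ : ∃ u : n → ℂ, π *ᵥ u ≠ 0 := by
    by_contra! hcon
    exact h0 (ext_of_mulVec_single fun i => by simp only [hcon, zero_mulVec])
  obtain ⟨c, hc⟩ := h _ hu (fixed u)
  refine ⟨c, ext_of_mulVec_single fun i => ?_⟩
  rw [← mulVec_mulVec, smul_mulVec]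
  set w := π *ᵥ Pi.single i 1 with hw_def
  have hw : π *ᵥ w = w := fixed _
  set v := π *ᵥ u with hv_def
  have hv : π *ᵥ v = v := fixed _
  have of_multiple (t : ℂ) (ht : w = t • v) : A *ᵥ w = c • w := by
    rw [ht, mulVec_smul, hc, smul_comm]
  by_cases hw0 : w = 0
  · simp [hw0]
  by_cases hs0 : v + w = 0
  · exact of_multiple (-1) (by rw [neg_one_smul]; exact (neg_eq_of_add_eq_zero_right hs0).symm)
  obtain ⟨b, hb⟩ := h w hw0 hw
  obtain ⟨e, he⟩ := h (v + w) hs0 (by rw [mulVec_add, hv, hw])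
  rw [mulVec_add, hc, hb, smul_add] at he
  have hlin : (c - e) • v = (e - b) • w := by
    rw [sub_smul, sub_smul, sub_eq_sub_iff_add_eq_add, he, add_comm]
  by_cases heb : e - b = 0
  · rw [heb, zero_smul, smul_eq_zero, or_iff_left hu, sub_eq_zero] at hlin
    rw [hb, hlin, sub_eq_zero.1 heb]
  · refine of_multiple ((e - b)⁻¹ * (c - e)) ?_
    rw [mul_smul, hlin, inv_smul_smul₀ heb]

/-- If a sum of Kraus operators fixes all density matrices supported on the range of `π`, then each
of them is scalar on that range. -/
lemma exists_mul_eq_smul_of_sum_conj_eq {n κ : Type*} [Fintype n] [Fintype κ]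
    {π : Matrix n n ℂ} (hπ : π.IsHermitian) (hπ' : π * π = π) (A : κ → Matrix n n ℂ)
    (h : ∀ P : Matrix n n ℂ, P.PosSemidef → P.trace = 1 → π * P * π = P →
      ∑ j, A j * P * (A j)ᴴ = P) (j : κ) :
    ∃ c : ℂ, A j * π = c • π := by
  refine exists_mul_eq_smul_of_forall_mulVec hπ' fun v hv hπv => ?_
  have hvv : v ⬝ᵥ star v ≠ 0 := fun h0 => hv (dotProduct_self_star_eq_zero.1 h0)
  have hsupp : π * vecMulVec v (star v) * π = vecMulVec v (star v) := by
    rw [mul_vecMulVec, hπv, vecMulVec_mul, ← hπ.eq, ← star_mulVec, hπv]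
  have hP := h ((v ⬝ᵥ star v)⁻¹ • vecMulVec v (star v))
    ((posSemidef_vecMulVec_self_star v).smul (inv_nonneg.2 (dotProduct_self_star_nonneg v)))
    (by rw [trace_smul, trace_vecMulVec, smul_eq_mul, inv_mul_cancel₀ hvv])
    (by rw [Matrix.mul_smul, Matrix.smul_mul, hsupp])
  simp only [Matrix.mul_smul, Matrix.smul_mul, ← Finset.smul_sum] at hP
  have hsum := smul_right_injective _ (inv_ne_zero hvv) hP
  refine exists_eq_smul_of_sum_vecMulVec_eq (fun i => A i *ᵥ v) hv ?_ j
  simpa only [mul_vecMulVec, vecMulVec_mul, ← star_mulVec] using hsum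

/-- A recovery operation exists for errors satisfying the Knill–Laflamme criterion with a diagonal
coefficient matrix. -/
lemma exists_recovery_of_diagonal {n ι : Type*} [Fintype n] [DecidableEq n] [Fintype ι]
    [DecidableEq ι] {π : Matrix n n ℂ} (hπ : π.IsHermitian) (hπ' : π * π = π)
    (F : ι → Matrix n n ℂ) (D : ι → ℝ) (hD : ∀ k, 0 ≤ D k) (hD1 : ∑ k, D k = 1)
    (hF : ∀ k l, π * (F k)ᴴ * F l * π = diagonal (fun i => (D i : ℂ)) k l • π) :
    ∃ R : Option ι → Matrix n n ℂ, (∑ b, (R b)ᴴ * R b = 1) ∧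
      ∀ P, π * P * π = P → ∑ b, ∑ a, R b * F a * P * (F a)ᴴ * (R b)ᴴ = P := by
  have zero_of (k : ι) (hk : D k = 0) : F k * π = 0 := by
    rw [← conjTranspose_mul_self_eq_zero, conjTranspose_mul, hπ.eq, ← Matrix.mul_assoc, hF]
    simp [hk]
  have sq (k : ι) : ((√(D k) : ℝ) : ℂ) * (√(D k) : ℝ) = D k := by
    rw [← Complex.ofReal_mul, Real.mul_self_sqrt (hD k)]
  let S : ι → Matrix n n ℂ := fun k => ((√(D k) : ℝ) : ℂ)⁻¹ • (π * (F k)ᴴ)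
  let Q : Matrix n n ℂ := ∑ k, (S k)ᴴ * S k
  have hS (k l : ι) : S k * F l * π = if k = l then ((√(D k) : ℝ) : ℂ) • π else 0 := by
    simp only [S, Matrix.smul_mul, hF, diagonal_apply]
    split_ifs
    · rw [smul_smul, ← sq, ← mul_assoc]
      by_cases h0 : ((√(D k) : ℝ) : ℂ) = 0
      · simp [h0]
      · rw [inv_mul_cancel₀ h0, one_mul]
    · simp
  have hSH (k : ι) : (S k)ᴴ = ((√(D k) : ℝ) : ℂ)⁻¹ • (F k * π) := by
    simp [S, hπ.eq, conjTranspose_mul]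
  have hQF (l : ι) : Q * (F l * π) = F l * π := by
    simp only [Q, Finset.sum_mul, Matrix.mul_assoc]
    simp only [← Matrix.mul_assoc (S _), hS, mul_ite, mul_zero, Finset.sum_ite_eq',
      Finset.mem_univ, if_true]
    rw [hSH, Matrix.smul_mul, Matrix.mul_smul, smul_smul, Matrix.mul_assoc, hπ']
    by_cases h0 : D l = 0
    · simp [zero_of l h0]
    · rw [inv_mul_cancel₀, one_smul]
      exact Complex.ofReal_ne_zero.2 (Real.sqrt_ne_zero'.2 ((hD l).lt_of_ne' h0))
  have hQH : Qᴴ = Q := by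
    simp [Q, conjTranspose_sum, conjTranspose_mul]
  have hQQ : Q * Q = Q := by
    change Q * ∑ k, (S k)ᴴ * S k = _
    rw [Finset.mul_sum]
    refine Finset.sum_congr rfl fun k _ => ?_
    have hQS : Q * (S k)ᴴ = (S k)ᴴ := by rw [hSH, Matrix.mul_smul, hQF]
    rw [← Matrix.mul_assoc, hQS]
  refine ⟨fun b => b.elim (1 - Q) S, ?_, fun P hP => ?_⟩
  · rw [Fintype.sum_option]
    change (1 - Q)ᴴ * (1 - Q) + Q = 1
    rw [conjTranspose_sub, conjTranspose_one, hQH, sub_mul, mul_sub, mul_sub, hQQ]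
    simp
  · have expand (R B : Matrix n n ℂ) : R * B * P * Bᴴ * Rᴴ = (R * B * π) * P * (R * B * π)ᴴ := by
      conv_lhs => rw [← hP]
      simp only [conjTranspose_mul, hπ.eq, Matrix.mul_assoc]
    have h0 (a : ι) : (1 - Q) * F a * π = 0 := by
      rw [Matrix.mul_assoc, sub_mul, hQF, one_mul, sub_self]
    simp only [expand, Fintype.sum_option, Option.elim, h0, hS]
    have h1 (k a : ι) : (if k = a then ((√(D k) : ℝ) : ℂ) • π else 0) * P *
        (if k = a then ((√(D k) : ℝ) : ℂ) • π else 0)ᴴ = if k = a then (D k : ℂ) • P else 0 := by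
      split_ifs
      · rw [conjTranspose_smul, hπ.eq, Matrix.smul_mul, Matrix.smul_mul, Matrix.mul_smul, hP,
          smul_smul, ← sq]
        simp
      · simp
    simp only [h1, Matrix.zero_mul, Finset.sum_const_zero, zero_add, Finset.sum_ite_eq,
      Finset.mem_univ, if_true]
    rw [← Finset.sum_smul, ← Complex.ofReal_sum, hD1, Complex.ofReal_one, one_smul]

/-- Unitary freedom in the operator-sum representation. -/
lemma sum_conj_unitary_mix {n ι : Type*} [Fintype n] [Fintype ι] [DecidableEq ι]
    (E : ι → Matrix n n ℂ) {U : Matrix ι ι ℂ} (hU : U * Uᴴ = 1) (X : Matrix n n ℂ) :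
    ∑ k, (∑ a, U a k • E a) * X * (∑ a, U a k • E a)ᴴ = ∑ a, E a * X * (E a)ᴴ := by
  simp only [conjTranspose_sum, conjTranspose_smul, Finset.sum_mul, Finset.mul_sum,
    Matrix.smul_mul, Matrix.mul_smul, smul_smul]
  rw [Finset.sum_comm]
  conv_lhs => enter [2, a]; rw [Finset.sum_comm]
  have hrow (a b : ι) : ∑ k, star (U b k) * U a k = (1 : Matrix ι ι ℂ) a b := by
    simp only [← hU, mul_apply, conjTranspose_apply, mul_comm]
  simp [← Finset.sum_smul, hrow, one_apply, -Complex.star_def, -RCLike.star_def]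

/-- Knill–Laflamme: the projector criterion yields a recovery operation. -/
lemma exists_recovery_of_criterion {n ι : Type*} [Fintype n] [DecidableEq n] [Fintype ι]
    {π : Matrix n n ℂ} (hπ : π.IsHermitian) (hπ' : π * π = π) (h0 : π ≠ 0)
    (E : ι → Matrix n n ℂ) (hE : ∑ a, (E a)ᴴ * E a = 1) (c : Matrix ι ι ℂ)
    (hc : ∀ a b, π * (E a)ᴴ * E b * π = c a b • π) :
    ∃ R : Option ι → Matrix n n ℂ, (∑ b, (R b)ᴴ * R b = 1) ∧
      ∀ P, π * P * π = P → ∑ b, ∑ a, R b * E a * P * (E a)ᴴ * (R b)ᴴ = P := by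
  classical
  have inj : Function.Injective fun z : ℂ => z • π := smul_left_injective ℂ h0
  have hcH : c.IsHermitian := by
    ext a b
    refine inj ?_
    change star (c b a) • π = c a b • π
    rw [← hc, ← congrArg (star (c b a) • ·) hπ.eq, ← conjTranspose_smul, ← hc]
    simp only [conjTranspose_mul, conjTranspose_conjTranspose, hπ.eq, Matrix.mul_assoc]
  let U : Matrix ι ι ℂ := hcH.eigenvectorUnitary
  let D : ι → ℝ := hcH.eigenvalues
  have hUU : U * Uᴴ = 1 := Unitary.coe_mul_star_self hcH.eigenvectorUnitary
  have hdiag : Uᴴ * c * U = diagonal fun i => (D i : ℂ) := by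
    have := hcH.conjStarAlgAut_star_eigenvectorUnitary
    rw [Unitary.conjStarAlgAut_star_apply] at this
    exact this
  let F : ι → Matrix n n ℂ := fun k => ∑ a, U a k • E a
  have hF (k l : ι) : π * (F k)ᴴ * F l * π = diagonal (fun i => (D i : ℂ)) k l • π := by
    rw [← hdiag]
    simp only [F, conjTranspose_sum, conjTranspose_smul, Finset.sum_mul, Finset.mul_sum,
      Matrix.smul_mul, Matrix.mul_smul, hc, smul_smul, mul_apply, Finset.sum_smul,
      conjTranspose_apply]
    exact Finset.sum_congr rfl fun x _ => Finset.sum_congr rfl fun y _ => by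
      rw [mul_comm (star _ * _), mul_assoc]
  have hD (k : ι) : 0 ≤ D k := by
    have h1 : ((F k * π)ᴴ * (F k * π)).trace = (D k : ℂ) * π.trace := by
      rw [conjTranspose_mul, hπ.eq, ← Matrix.mul_assoc, hF, diagonal_apply_eq, trace_smul,
        smul_eq_mul]
    have h2 := (posSemidef_conjTranspose_mul_self (F k * π)).trace_nonneg
    have hπpos : π.PosSemidef := by
      simpa [hπ.eq, hπ'] using posSemidef_conjTranspose_mul_self π
    have h3 : 0 < π.trace := hπpos.trace_nonneg.lt_of_ne' (mt hπpos.trace_eq_zero_iff.1 h0)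
    rw [h1] at h2
    rw [Complex.pos_iff] at h3
    rw [Complex.nonneg_iff, Complex.re_ofReal_mul] at h2
    exact nonneg_of_mul_nonneg_left h2.1 h3.1
  have hD1 : ∑ k, D k = 1 := by
    have htr : c.trace = 1 := by
      refine inj ?_
      have := congrArg (fun M => π * M * π) hE
      simp only [Finset.mul_sum, Finset.sum_mul, ← Matrix.mul_assoc, hc, ← Finset.sum_smul,
        mul_one, hπ'] at this
      exact this.trans (one_smul ℂ π).symm
    have := congrArg trace hdiag
    rw [Matrix.trace_mul_comm, ← Matrix.mul_assoc, hUU, one_mul, htr, trace_diagonal] at this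
    exact_mod_cast this.symm
  obtain ⟨R, hR1, hR2⟩ := exists_recovery_of_diagonal hπ hπ' F D hD hD1 hF
  refine ⟨R, hR1, fun P hP => ?_⟩
  refine Eq.trans (Finset.sum_congr rfl fun b _ => ?_) (hR2 P hP)
  have hmix : ∑ a, E a * P * (E a)ᴴ = ∑ k, F k * P * (F k)ᴴ :=
    (sum_conj_unitary_mix E hUU P).symm
  have pull (G : ι → Matrix n n ℂ) :
      ∑ a, R b * G a * P * (G a)ᴴ * (R b)ᴴ = R b * (∑ a, G a * P * (G a)ᴴ) * (R b)ᴴ := by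
    simp only [Finset.mul_sum, Finset.sum_mul, Matrix.mul_assoc]
  rw [pull, pull, hmix]

/-- Knill–Laflamme / Nielsen–Chuang theorem 10.1: for errors (E_a) with
Σ_a E_a† E_a = Id and π the orthogonal projector onto the code subspace C ⊆ ℂ^d,
a recovery operation (R_b) (with Σ_b R_b† R_b = Id, inverting the error superoperator
on all density matrices supported on C) exists if and only if
π E_a† E_b π = c_{ab} π for some constants c_{ab}. -/
theorem recovery_exists_iff_projector_criterion {d : ℕ}
    (C : Submodule ℂ (Fin d → ℂ)) (π : Matrix (Fin d) (Fin d) ℂ)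
    (hπherm : π.IsHermitian) (hπidem : π * π = π)
    (hπrange : LinearMap.range π.mulVecLin = C)
    {ι : Type*} [Fintype ι] (E : ι → Matrix (Fin d) (Fin d) ℂ)
    (hE : ∑ a : ι, (E a)ᴴ * E a = 1) :
    (∃ (s : ℕ) (R : Fin s → Matrix (Fin d) (Fin d) ℂ),
        (∑ b : Fin s, (R b)ᴴ * R b = 1) ∧
        ∀ P : Matrix (Fin d) (Fin d) ℂ, P.PosSemidef → P.trace = 1 →
          π * P * π = P →
          ∑ b : Fin s, ∑ a : ι, R b * E a * P * (E a)ᴴ * (R b)ᴴ = P)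
      ↔
    (∃ c : ι → ι → ℂ, ∀ a b : ι, π * (E a)ᴴ * E b * π = c a b • π) := by
  constructor
  · rintro ⟨s, R, hR, hrec⟩
    have hscalar := exists_mul_eq_smul_of_sum_conj_eq hπherm hπidem
      (fun p : Fin s × ι => R p.1 * E p.2) fun P h1 h2 h3 => by
        simpa only [Fintype.sum_prod_type, conjTranspose_mul, Matrix.mul_assoc] using
          hrec P h1 h2 h3
    choose r hr using hscalar
    refine ⟨fun a b => ∑ k, star (r (k, a)) * r (k, b), fun a b => ?_⟩
    calc π * (E a)ᴴ * E b * π = π * (E a)ᴴ * (∑ k, (R k)ᴴ * R k) * E b * π := by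
          rw [hR, mul_one]
      _ = ∑ k, (R k * E a * π)ᴴ * (R k * E b * π) := by
          simp only [Finset.mul_sum, Finset.sum_mul, conjTranspose_mul, hπherm.eq,
            Matrix.mul_assoc]
      _ = _ := by
          rw [Finset.sum_smul]
          refine Finset.sum_congr rfl fun k _ => ?_
          rw [hr (k, a), hr (k, b), conjTranspose_smul, hπherm.eq, Matrix.smul_mul,
            Matrix.mul_smul, hπidem, smul_smul]
  · rintro ⟨c, hc⟩
    by_cases h0 : π = 0
    · refine ⟨1, fun _ => 1, by simp, fun P _ htr hP => ?_⟩
      have : P = 0 := by rw [← hP, h0]; simp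
      simp [this] at htr
    obtain ⟨R, hR1, hR2⟩ := exists_recovery_of_criterion hπherm hπidem h0 E hE (of c) hc
    let e := (Fintype.equivFin (Option ι)).symm
    refine ⟨_, R ∘ e, ?_, fun P _ _ hP => ?_⟩
    · rw [← hR1]
      exact e.sum_comp fun b => (R b)ᴴ * R b
    · refine Eq.trans ?_ (hR2 P hP)
      exact e.sum_comp fun b => ∑ a, R b * E a * P * (E a)ᴴ * (R b)ᴴ
end

section
/- Let W = ℂ^d with its standard Hermitian inner product, let C ⊆ W be a linear subspace with orthogonal projection π : W → W onto C, and let (E_a)_{a∈ι} be a finite family of linear operators on W satisfying Σ_a E_a† E_a = Id. Then there exists a finite family of linear operators (R_b)_{b∈κ} on W with Σ_b R_b† R_b = Id such that Σ_b Σ_a R_b E_a P E_a† R_b† = P for every positive semidefinite operator P of trace 1 with π P π = P, if and only if for all a, b ∈ ι the value ⟨ψ, E_a† E_b ψ⟩ is the same for every unit vector ψ ∈ C. -/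
open Matrix
open scoped ComplexOrder

namespace Matrix

section CollinearImage

variable {n κ : Type*} [Fintype n] [Fintype κ]

/-- If a completely positive map fixes a pure state, then the state is an eigenvector of
each of its Kraus operators. -/
lemma exists_mulVec_eq_smul_of_sum_conj_pure_eq (B : κ → Matrix n n ℂ) {ψ : n → ℂ}
    (hψ : star ψ ⬝ᵥ ψ = 1)
    (h : ∑ k, B k * vecMulVec ψ (star ψ) * (B k)ᴴ = vecMulVec ψ (star ψ)) (k : κ) :
    ∃ c : ℂ, B k *ᵥ ψ = c • ψ := by
  have orth (χ : n → ℂ) (hχ : star χ ⬝ᵥ ψ = 0) : star χ ⬝ᵥ (B k *ᵥ ψ) = 0 := by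
    have h1 := congrArg (fun M : Matrix n n ℂ => star χ ⬝ᵥ (M *ᵥ χ)) h
    have h2 (l : κ) : star χ ⬝ᵥ ((B l * vecMulVec ψ (star ψ) * (B l)ᴴ) *ᵥ χ)
        = star (star χ ⬝ᵥ (B l *ᵥ ψ)) * (star χ ⬝ᵥ (B l *ᵥ ψ)) := by
      rw [mul_vecMulVec, vecMulVec_mul, ← star_mulVec, vecMulVec_mulVec, dotProduct_smul,
        star_dotProduct (B l *ᵥ ψ) χ, op_smul_eq_smul, smul_eq_mul]
    simp only [sum_mulVec, dotProduct_sum, h2] at h1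
    rw [vecMulVec_mulVec, dotProduct_smul, hχ, smul_zero,
      Finset.sum_eq_zero_iff_of_nonneg fun _ _ => star_mul_self_nonneg _] at h1
    simpa using h1 k (Finset.mem_univ k)
  set c := star ψ ⬝ᵥ (B k *ᵥ ψ) with hc
  refine ⟨c, ?_⟩
  set χ := B k *ᵥ ψ - c • ψ with hχ
  have h0 : star ψ ⬝ᵥ χ = 0 := by
    simp [hχ, dotProduct_sub, hψ, ← hc]
  have h0' : star χ ⬝ᵥ ψ = 0 := by rw [star_dotProduct, h0, star_zero]
  have h3 : star χ ⬝ᵥ χ = 0 := by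
    conv_lhs => rw [hχ, dotProduct_sub, dotProduct_smul, ← hχ, h0', orth χ h0']
    simp
  exact sub_eq_zero.1 (dotProduct_star_self_eq_zero.1 h3)

/-- A matrix acting on every vector of a subspace as some scalar acts as a single scalar. -/
lemma exists_forall_mulVec_eq_smul (C : Submodule ℂ (n → ℂ)) (A : Matrix n n ℂ)
    (h : ∀ v ∈ C, ∃ c : ℂ, A *ᵥ v = c • v) : ∃ c : ℂ, ∀ v ∈ C, A *ᵥ v = c • v := by
  have hA (v : n → ℂ) (hv : v ∈ C) : A.mulVecLin v ∈ C := by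
    obtain ⟨c, hc⟩ := h v hv
    rw [mulVecLin_apply, hc]
    exact C.smul_mem c hv
  obtain ⟨c, hc⟩ := (A.mulVecLin.restrict hA).exists_eq_smul_id_of_forall_notLinearIndependent
    fun v => by
      obtain ⟨c, hc⟩ := h v v.2
      rw [LinearIndependent.pair_iff]
      intro hli
      have := (hli c (-1) (by ext1; simp [hc])).2
      simp at this
  refine ⟨c, fun v hv => ?_⟩
  simpa using congrArg Subtype.val (LinearMap.congr_fun hc ⟨v, hv⟩)

/-- Every nonzero complex vector is a scalar multiple of a unit vector, and conversely. -/
lemma exists_unit_smul_eq {v : n → ℂ} (hv : v ≠ 0) :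
    ∃ (ψ : n → ℂ) (r : ℂ), star ψ ⬝ᵥ ψ = 1 ∧ v = r • ψ ∧ ψ = r⁻¹ • v := by
  obtain ⟨x, hx0, hx⟩ := RCLike.nonneg_iff_exists_ofReal.1 (dotProduct_star_self_nonneg v)
  have hx1 : x ≠ 0 := by
    rintro rfl
    exact hv (dotProduct_star_self_eq_zero.1 (by rw [← hx]; simp))
  have hs : ((√x : ℝ) : ℂ) ≠ 0 := by
    simpa using Real.sqrt_ne_zero'.2 (lt_of_le_of_ne hx0 hx1.symm)
  have hss : ((√x : ℝ) : ℂ) * (√x : ℝ) = x := by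
    rw [← Complex.ofReal_mul, Real.mul_self_sqrt hx0]
  refine ⟨((√x : ℝ) : ℂ)⁻¹ • v, (√x : ℝ), ?_, ?_, rfl⟩
  · rw [star_smul, smul_dotProduct, dotProduct_smul, ← hx, star_inv₀]
    simp only [smul_eq_mul, RCLike.star_def, Complex.conj_ofReal, Complex.coe_algebraMap]
    rw [← hss]
    field_simp
  · rw [smul_smul, mul_inv_cancel₀ hs, one_smul]

/-- A complex matrix with vanishing quadratic form is zero. -/
lemma eq_zero_of_forall_star_dotProduct_mulVec_eq_zero (M : Matrix n n ℂ)
    (h : ∀ v : n → ℂ, star v ⬝ᵥ (M *ᵥ v) = 0) : M = 0 := by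
  classical
  have h0 : Matrix.toEuclideanLin M = 0 := by
    rw [← inner_map_self_eq_zero]
    intro x
    rw [← inner_conj_symm, EuclideanSpace.inner_eq_star_dotProduct, dotProduct_comm]
    simpa [toLpLin_apply] using h x.ofLp
  simpa using h0

end CollinearImage

section Recovery

variable {n κ ι : Type*} [Fintype n] [DecidableEq n] [Fintype κ] [DecidableEq κ] [Fintype ι]

/-- Kraus operators `F k` sending the range of a projector `π` to mutually orthogonal subspaces,
each one a multiple of an isometry, can be undone by an operation. -/
lemma exists_recovery_of_orthogonal (π : Matrix n n ℂ) (F : κ → Matrix n n ℂ) (D : κ → ℝ)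
    (hD : ∀ k, 0 ≤ D k) (hFπ : ∀ k, F k * π = F k)
    (hF : ∀ k l, (F k)ᴴ * F l = if k = l then (D k : ℂ) • π else 0) :
    ∃ R : Option κ → Matrix n n ℂ, ∑ b, (R b)ᴴ * R b = 1 ∧ (∀ l, R none * F l = 0) ∧
      ∀ k l, R (some k) * F l = if k = l then ((√(D k) : ℝ) : ℂ) • π else 0 := by
  have hF0 (k : κ) (hk : D k = 0) : F k = 0 := by
    rw [← conjTranspose_mul_self_eq_zero, hF]
    simp [hk]
  have hsq (k : κ) : (((√(D k))⁻¹ : ℝ) : ℂ) * (((√(D k))⁻¹ : ℝ) : ℂ) = ((D k : ℝ) : ℂ)⁻¹ := by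
    rw [← Complex.ofReal_mul, ← mul_inv, Real.mul_self_sqrt (hD k), Complex.ofReal_inv]
  have hsd (k : κ) : (((√(D k))⁻¹ : ℝ) : ℂ) * (D k : ℂ) = ((√(D k) : ℝ) : ℂ) := by
    rw [← Complex.ofReal_mul]
    congr 1
    by_cases hk : D k = 0
    · simp [hk]
    · have : √(D k) ≠ 0 := by simpa [Real.sqrt_eq_zero (hD k)] using hk
      field_simp
      exact (Real.sq_sqrt (hD k)).symm
  set Q : Matrix n n ℂ := ∑ k, ((D k : ℂ)⁻¹) • (F k * (F k)ᴴ) with hQ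
  have hQF (l : κ) : Q * F l = F l := by
    rw [hQ, Finset.sum_mul, Finset.sum_eq_single l]
    · rw [smul_mul_assoc, mul_assoc, hF, if_pos rfl, mul_smul_comm, hFπ, smul_smul]
      by_cases hl : D l = 0
      · simp [hF0 l hl]
      · rw [inv_mul_cancel₀ (by exact_mod_cast hl), one_smul]
    · intro k _ hkl
      rw [smul_mul_assoc, mul_assoc, hF, if_neg hkl, mul_zero, smul_zero]
    · simp
  have hQQ : Q * Q = Q := by
    conv_lhs => rw [hQ]
    conv_lhs => enter [1]; rw [← hQ]
    rw [Finset.mul_sum, hQ]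
    refine Finset.sum_congr rfl fun k _ => ?_
    rw [mul_smul_comm, ← mul_assoc, ← hQ, hQF]
  have hQH : Qᴴ = Q := by
    simp [hQ, conjTranspose_sum, conjTranspose_smul, conjTranspose_mul]
  refine ⟨fun b => b.elim (1 - Q) fun k => (((√(D k))⁻¹ : ℝ) : ℂ) • (F k)ᴴ, ?_, ?_, ?_⟩
  · have h1 (k : κ) : ((((√(D k))⁻¹ : ℝ) : ℂ) • (F k)ᴴ)ᴴ * ((((√(D k))⁻¹ : ℝ) : ℂ) • (F k)ᴴ)
        = ((D k : ℂ)⁻¹) • (F k * (F k)ᴴ) := by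
      rw [conjTranspose_smul, conjTranspose_conjTranspose, smul_mul_smul_comm, ← hsq]
      simp
    rw [Fintype.sum_option]
    simp only [Option.elim, h1, ← hQ]
    rw [conjTranspose_sub, conjTranspose_one, hQH, sub_mul, mul_sub, mul_sub, hQQ]
    simp
  · intro l
    simp [sub_mul, hQF]
  · intro k l
    simp only [Option.elim, smul_mul_assoc, hF, smul_ite, smul_zero, smul_smul, hsd]

/-- The Knill–Laflamme condition with a positive semidefinite matrix of constants is sufficient
for recovery. -/
lemma exists_recovery_of_posSemidef [DecidableEq ι] {π : Matrix n n ℂ} (hπherm : π.IsHermitian)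
    (hπidem : π * π = π) (E : ι → Matrix n n ℂ) {m : Matrix ι ι ℂ} (hm : m.PosSemidef)
    (htr : m.trace = 1) (h : ∀ a b, π * ((E a)ᴴ * E b) * π = m a b • π) :
    ∃ R : Option ι → Matrix n n ℂ, ∑ b, (R b)ᴴ * R b = 1 ∧
      ∀ P : Matrix n n ℂ, π * P * π = P →
        ∑ b, ∑ a, R b * E a * P * (E a)ᴴ * (R b)ᴴ = P := by
  obtain ⟨U, D, hD, hUU, hUU', hdiag, hsum⟩ : ∃ (U : Matrix ι ι ℂ) (D : ι → ℝ), (∀ k, 0 ≤ D k) ∧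
      Uᴴ * U = 1 ∧ U * Uᴴ = 1 ∧ Uᴴ * m * U = diagonal (fun k => (D k : ℂ)) ∧
      ∑ k, (D k : ℂ) = 1 := by
    refine ⟨hm.1.eigenvectorUnitary, hm.1.eigenvalues, hm.eigenvalues_nonneg,
      Unitary.coe_star_mul_self _, Unitary.coe_mul_star_self _, ?_, ?_⟩
    · have := hm.1.conjStarAlgAut_star_eigenvectorUnitary
      rw [Unitary.conjStarAlgAut_star_apply] at this
      exact this
    · rw [← htr, hm.1.trace_eq_sum_eigenvalues]
      rfl
  have hE' (a b : ι) : (E a * π)ᴴ * (E b * π) = m a b • π := by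
    rw [← h, conjTranspose_mul, hπherm.eq]
    simp only [mul_assoc]
  set F : ι → Matrix n n ℂ := fun k => ∑ a, U a k • (E a * π) with hFdef
  have hFπ (k : ι) : F k * π = F k := by
    simp [hFdef, Finset.sum_mul, mul_assoc, hπidem]
  have hF (k l : ι) : (F k)ᴴ * F l = if k = l then (D k : ℂ) • π else 0 := by
    have h1 : (F k)ᴴ * F l = (Uᴴ * m * U) k l • π := by
      rw [hFdef, conjTranspose_sum, Finset.sum_mul_sum]
      simp only [conjTranspose_smul, smul_mul_smul_comm, hE', smul_smul, mul_apply,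
        conjTranspose_apply, Finset.sum_mul, Finset.sum_smul]
      rw [Finset.sum_comm]
      refine Finset.sum_congr rfl fun b _ => Finset.sum_congr rfl fun a _ => ?_
      rw [mul_right_comm]
    rw [h1, hdiag, diagonal_apply]
    split_ifs <;> simp
  have hEF (a : ι) : E a * π = ∑ k, star (U a k) • F k := by
    have h1 : ∑ k, star (U a k) • F k = ∑ b, (U * Uᴴ) b a • (E b * π) := by
      simp only [hFdef, Finset.smul_sum, smul_smul, mul_apply, conjTranspose_apply,
        Finset.sum_smul]
      rw [Finset.sum_comm]
      refine Finset.sum_congr rfl fun b _ => Finset.sum_congr rfl fun k _ => ?_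
      rw [mul_comm]
    rw [h1, hUU']
    simp [one_apply]
  obtain ⟨R, hR, hRn, hRs⟩ := exists_recovery_of_orthogonal π F D hD hFπ hF
  refine ⟨R, hR, fun P hP => ?_⟩
  have hconj (b : Option ι) (a : ι) :
      R b * E a * P * (E a)ᴴ * (R b)ᴴ = (R b * (E a * π)) * P * (R b * (E a * π))ᴴ := by
    conv_lhs => rw [← hP]
    simp only [conjTranspose_mul, hπherm.eq, mul_assoc]
  have hnone (a : ι) : R none * (E a * π) = 0 := by
    rw [hEF, Finset.mul_sum]
    simp [hRn]
  have hsome (k a : ι) : R (some k) * (E a * π) = (star (U a k) * ((√(D k) : ℝ) : ℂ)) • π := by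
    rw [hEF, Finset.mul_sum]
    simp only [mul_smul_comm, hRs, smul_ite, smul_zero, smul_smul, Finset.sum_ite_eq,
      Finset.mem_univ, if_true]
  have hcol (k : ι) : ∑ a, star (U a k) * U a k = 1 := by
    have := congrFun (congrFun hUU k) k
    simpa [mul_apply] using this
  have hterm (k a : ι) : (R (some k) * (E a * π)) * P * (R (some k) * (E a * π))ᴴ
      = ((D k : ℂ) * (star (U a k) * U a k)) • P := by
    rw [hsome, conjTranspose_smul, hπherm.eq, smul_mul_assoc, smul_mul_smul_comm, hP]
    congr 1
    have : ((√(D k) : ℝ) : ℂ) * (√(D k) : ℝ) = D k := by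
      rw [← Complex.ofReal_mul, Real.mul_self_sqrt (hD k)]
    rw [← this]
    simp
    ring
  simp only [hconj, Fintype.sum_option, hnone, hterm]
  simp only [← Finset.sum_smul, ← Finset.mul_sum, hcol, mul_one, hsum]
  simp

end Recovery

end Matrix

/-- A recovery operation for the errors (E_a) (with Σ_a E_a† E_a = Id) on the code
subspace C ⊆ ℂ^d (with orthogonal projector π) exists if and only if for all a, b the
expectation ⟨ψ, E_a† E_b ψ⟩ is the same for every unit vector ψ ∈ C. -/
theorem recovery_exists_iff_constant_expectation {d : ℕ}
    (C : Submodule ℂ (Fin d → ℂ)) (π : Matrix (Fin d) (Fin d) ℂ)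
    (hπherm : π.IsHermitian) (hπidem : π * π = π)
    (hπrange : LinearMap.range π.mulVecLin = C)
    {ι : Type*} [Fintype ι] (E : ι → Matrix (Fin d) (Fin d) ℂ)
    (hE : ∑ a : ι, (E a)ᴴ * E a = 1) :
    (∃ (s : ℕ) (R : Fin s → Matrix (Fin d) (Fin d) ℂ),
        (∑ b : Fin s, (R b)ᴴ * R b = 1) ∧
        ∀ P : Matrix (Fin d) (Fin d) ℂ, P.PosSemidef → P.trace = 1 →
          π * P * π = P →
          ∑ b : Fin s, ∑ a : ι, R b * E a * P * (E a)ᴴ * (R b)ᴴ = P)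
      ↔
    (∀ a b : ι, ∀ ψ φ : Fin d → ℂ, ψ ∈ C → φ ∈ C →
        star ψ ⬝ᵥ ψ = 1 → star φ ⬝ᵥ φ = 1 →
        star ψ ⬝ᵥ (((E a)ᴴ * E b).mulVec ψ) = star φ ⬝ᵥ (((E a)ᴴ * E b).mulVec φ)) := by
  have hfix (v : Fin d → ℂ) (hv : v ∈ C) : π *ᵥ v = v := by
    rw [← hπrange] at hv
    obtain ⟨w, rfl⟩ := hv
    simp [mulVec_mulVec, hπidem]
  have hmem (v : Fin d → ℂ) : π *ᵥ v ∈ C := by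
    rw [← hπrange]
    exact ⟨v, rfl⟩
  have hadj (A B : Matrix (Fin d) (Fin d) ℂ) (v w : Fin d → ℂ) :
      star v ⬝ᵥ ((Aᴴ * B) *ᵥ w) = star (A *ᵥ v) ⬝ᵥ (B *ᵥ w) := by
    rw [← mulVec_mulVec, dotProduct_mulVec, star_mulVec]
  constructor
  · rintro ⟨s, R, hR, hrec⟩
    have hunit (ψ : Fin d → ℂ) (hψ : ψ ∈ C) (h1 : star ψ ⬝ᵥ ψ = 1) (b : Fin s) (a : ι) :
        ∃ c : ℂ, (R b * E a) *ᵥ ψ = c • ψ := by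
      refine exists_mulVec_eq_smul_of_sum_conj_pure_eq
        (fun k : Fin s × ι => R k.1 * E k.2) h1 ?_ (b, a)
      rw [Fintype.sum_prod_type]
      have := hrec (vecMulVec ψ (star ψ)) (posSemidef_vecMulVec_self_star ψ)
        (by rw [trace_vecMulVec, dotProduct_comm, h1])
        (by
          rw [mul_vecMulVec, vecMulVec_mul, hfix ψ hψ]
          have := star_mulVec π ψ
          rw [hπherm.eq, hfix ψ hψ] at this
          rw [← this])
      simpa only [conjTranspose_mul, mul_assoc] using this
    have hscal (b : Fin s) (a : ι) : ∃ c : ℂ, ∀ v ∈ C, (R b * E a) *ᵥ v = c • v := by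
      refine exists_forall_mulVec_eq_smul C _ fun v hv => ?_
      by_cases hv0 : v = 0
      · exact ⟨0, by simp [hv0]⟩
      obtain ⟨ψ, r, h1, hvr, hψ⟩ := exists_unit_smul_eq hv0
      obtain ⟨c, hc⟩ := hunit ψ (hψ ▸ C.smul_mem _ hv) h1 b a
      exact ⟨c, by rw [hvr, mulVec_smul, hc, smul_comm]⟩
    choose c hc using hscal
    have hval (a b : ι) (ψ : Fin d → ℂ) (hψ : ψ ∈ C) (h1 : star ψ ⬝ᵥ ψ = 1) :
        star ψ ⬝ᵥ (((E a)ᴴ * E b) *ᵥ ψ) = ∑ r, star (c r a) * c r b := by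
      have h2 : (E a)ᴴ * E b = ∑ r, (R r * E a)ᴴ * (R r * E b) := by
        calc (E a)ᴴ * E b = (E a)ᴴ * (∑ r, (R r)ᴴ * R r) * E b := by rw [hR, mul_one]
          _ = _ := by
            simp only [Finset.mul_sum, Finset.sum_mul, conjTranspose_mul, mul_assoc]
      rw [h2, sum_mulVec, dotProduct_sum]
      refine Finset.sum_congr rfl fun r _ => ?_
      rw [hadj, hc r a ψ hψ, hc r b ψ hψ, star_smul, smul_dotProduct, dotProduct_smul, h1]
      simp
    intro a b ψ φ hψ hφ hψ1 hφ1
    rw [hval a b ψ hψ hψ1, hval a b φ hφ hφ1]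
  · intro hconst
    classical
    suffices H : ∃ R : Option ι → Matrix (Fin d) (Fin d) ℂ, ∑ b, (R b)ᴴ * R b = 1 ∧
        ∀ P : Matrix (Fin d) (Fin d) ℂ, P.trace = 1 → π * P * π = P →
          ∑ b, ∑ a, R b * E a * P * (E a)ᴴ * (R b)ᴴ = P by
      obtain ⟨R, hR, hrec⟩ := H
      let e := (Fintype.equivFin (Option ι)).symm
      refine ⟨Fintype.card (Option ι), R ∘ e, ?_, fun P _ hP1 hP => ?_⟩
      · rw [← hR]
        exact e.sum_comp fun b => (R b)ᴴ * R b
      · exact (e.sum_comp fun b => ∑ a, R b * E a * P * (E a)ᴴ * (R b)ᴴ).trans (hrec P hP1 hP)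
    by_cases hC : ∃ v ∈ C, v ≠ 0
    · obtain ⟨v, hv, hv0⟩ := hC
      obtain ⟨ψ, r, h1, -, hψr⟩ := exists_unit_smul_eq hv0
      have hψ : ψ ∈ C := hψr ▸ C.smul_mem _ hv
      let V : Matrix (Fin d) ι ℂ := of fun i a => (E a *ᵥ ψ) i
      have hV (a b : ι) : (Vᴴ * V) a b = star ψ ⬝ᵥ (((E a)ᴴ * E b) *ᵥ ψ) := by
        rw [hadj]
        simp [V, mul_apply, dotProduct]
      suffices hKL : (Vᴴ * V).trace = 1 ∧
          ∀ a b, π * ((E a)ᴴ * E b) * π = (Vᴴ * V) a b • π by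
        obtain ⟨R, hR, hrec⟩ := exists_recovery_of_posSemidef hπherm hπidem E
          (posSemidef_conjTranspose_mul_self V) hKL.1 hKL.2
        exact ⟨R, hR, fun P _ hP => hrec P hP⟩
      constructor
      · simp only [trace, diag_apply, hV]
        rw [← dotProduct_sum, ← sum_mulVec, hE, one_mulVec, h1]
      · intro a b
        rw [← sub_eq_zero]
        refine eq_zero_of_forall_star_dotProduct_mulVec_eq_zero _ fun w => ?_
        have hππ : π = πᴴ * π := by rw [hπherm.eq, hπidem]
        have hq : star w ⬝ᵥ ((π * ((E a)ᴴ * E b) * π) *ᵥ w)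
            = star (π *ᵥ w) ⬝ᵥ (((E a)ᴴ * E b) *ᵥ (π *ᵥ w)) := by
          rw [mulVec_mulVec, ← hadj, hπherm.eq, mul_assoc π]
        have hp : star w ⬝ᵥ (π *ᵥ w) = star (π *ᵥ w) ⬝ᵥ (π *ᵥ w) := by
          rw [← hadj, ← hππ]
        rw [sub_mulVec, dotProduct_sub, smul_mulVec, dotProduct_smul, hq, hp, hV]
        have hw := hmem w
        generalize π *ᵥ w = u at hw
        by_cases hu0 : u = 0
        · simp [hu0]
        obtain ⟨φ, t, hφ1, hut, hφt⟩ := exists_unit_smul_eq hu0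
        have hφ : φ ∈ C := hφt ▸ C.smul_mem _ hw
        rw [hconst a b ψ φ hψ hφ h1 hφ1, hut]
        simp only [star_smul, mulVec_smul, smul_dotProduct, dotProduct_smul, hφ1, smul_eq_mul]
        ring
    · have hπ0 : π = 0 := by
        refine eq_zero_of_forall_star_dotProduct_mulVec_eq_zero _ fun w => ?_
        have : π *ᵥ w = 0 := by
          by_contra h0
          exact hC ⟨_, hmem w, h0⟩
        rw [this, dotProduct_zero]
      refine ⟨fun b => b.elim 1 fun _ => 0, by simp [Fintype.sum_option], fun P hP1 hP => ?_⟩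
      have hP0 : P = 0 := by rw [← hP, hπ0]; simp
      simp [hP0] at hP1
end

section
/- Fix a real temperature T > 0 and a real magnetic field h, and let ε(p) = −4 cos p + 2h. For each n ≥ 1 let p^{(n)}_j = −π + 2πj/n for j = 0, 1, …, n−1. Then the limit as n → ∞ of (1/n)·log₂ ( Σ_{S ⊆ Fin n} 2^{ −(Σ_{j∈S} ε(p^{(n)}_j))/T } ) equals (1/(2π)) ∫_{−π}^{π} log₂ (1 + 2^{−ε(p)/T}) dp. -/
open Real Filter

/-- Left Riemann sums over equal subdivisions of a continuous function on `[a, b]` converge to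
its integral. -/
theorem tendsto_left_riemann_sum {f : ℝ → ℝ} {a b : ℝ} (hab : a ≤ b)
    (hf : ContinuousOn f (Set.Icc a b)) :
    Tendsto (fun n : ℕ => (b - a) / n * ∑ j ∈ Finset.range n, f (a + (b - a) * j / n))
      atTop (nhds (∫ x in a..b, f x)) := by
  rw [Metric.tendsto_atTop]
  intro ε hε
  have hba : 0 ≤ b - a := sub_nonneg.2 hab
  have hη : 0 < ε / (b - a + 1) := by positivity
  obtain ⟨δ, hδ, hfδ⟩ := Metric.uniformContinuousOn_iff.1
    (isCompact_Icc.uniformContinuousOn_of_continuous hf) _ hη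
  obtain ⟨N, hN⟩ := exists_nat_gt ((b - a) / δ)
  refine ⟨N + 1, fun n hn => ?_⟩
  have hn0 : (0 : ℝ) < n := by exact_mod_cast (by omega : 0 < n)
  have hNn : (N : ℝ) ≤ n := by exact_mod_cast (by omega : N ≤ n)
  have hstep : (b - a) / n < δ := by
    rw [div_lt_iff₀ hδ] at hN
    rw [div_lt_iff₀ hn0]
    nlinarith
  have hstep0 : 0 ≤ (b - a) / n := by positivity
  set x : ℕ → ℝ := fun j => a + (b - a) * j / n with hx
  have hx0 : x 0 = a := by simp [hx]
  have hxn : x n = b := by simp only [hx]; field_simp; ring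
  have hxs : ∀ j, x (j + 1) = x j + (b - a) / n := fun j => by
    simp only [hx]; push_cast; ring
  have hmono : Monotone x := monotone_nat_of_le_succ fun j => by rw [hxs]; linarith
  have hsub : ∀ j < n, Set.Icc (x j) (x (j + 1)) ⊆ Set.Icc a b := fun j hj =>
    Set.Icc_subset_Icc (hx0 ▸ hmono (Nat.zero_le j)) (hxn ▸ hmono hj)
  have hint : ∀ j < n, IntervalIntegrable f MeasureTheory.volume (x j) (x (j + 1)) :=
    fun j hj => (hf.mono (hsub j hj)).intervalIntegrable_of_Icc (hmono j.le_succ)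
  have hsplit : ∫ y in a..b, f y = ∑ j ∈ Finset.range n, ∫ y in x j..x (j + 1), f y := by
    rw [intervalIntegral.sum_integral_adjacent_intervals hint, hx0, hxn]
  have hpiece : ∀ j ∈ Finset.range n,
      ‖(b - a) / n * f (x j) - ∫ y in x j..x (j + 1), f y‖
        ≤ ε / (b - a + 1) * ((b - a) / n) := by
    intro j hj
    have hj := Finset.mem_range.1 hj
    have hconst : (b - a) / n * f (x j) = ∫ _ in x j..x (j + 1), f (x j) := by
      rw [intervalIntegral.integral_const, hxs, add_sub_cancel_left, smul_eq_mul]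
    rw [hconst, ← intervalIntegral.integral_sub intervalIntegrable_const (hint j hj)]
    have hbound := intervalIntegral.norm_integral_le_of_norm_le_const
      (a := x j) (b := x (j + 1)) (f := fun y => f (x j) - f y) (C := ε / (b - a + 1))
      fun y hy => by
        rw [Set.uIoc_of_le (hmono j.le_succ)] at hy
        rw [← dist_eq_norm]
        refine (hfδ _ (hsub j hj (Set.left_mem_Icc.2 (hmono j.le_succ))) _
          (hsub j hj (Set.Ioc_subset_Icc_self hy)) ?_).le
        rw [Real.dist_eq, abs_sub_comm, abs_of_pos (sub_pos.2 hy.1)]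
        have := hy.2
        rw [hxs] at this
        linarith
    rwa [hxs, add_sub_cancel_left, abs_of_nonneg hstep0, ← hxs] at hbound
  rw [hsplit, dist_eq_norm, Finset.mul_sum, ← Finset.sum_sub_distrib]
  refine (norm_sum_le_of_le _ hpiece).trans_lt ?_
  rw [Finset.sum_const, Finset.card_range, nsmul_eq_mul]
  calc (n : ℝ) * (ε / (b - a + 1) * ((b - a) / n)) = ε * ((b - a) / (b - a + 1)) := by
        field_simp
    _ < ε * 1 := by
        gcongr
        rw [div_lt_one (by linarith)]
        linarith
    _ = ε := mul_one ε

/-- The logarithm of a free-fermion partition function is the sum of the single-mode terms. -/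
theorem logb_sum_rpow_neg_sum_div {ι : Type*} [Fintype ι] [DecidableEq ι] (e : ι → ℝ) (T : ℝ) :
    Real.logb 2 (∑ S : Finset ι, (2 : ℝ) ^ (-(∑ j ∈ S, e j) / T)) =
      ∑ j, Real.logb 2 (1 + (2 : ℝ) ^ (-e j / T)) := by
  rw [← Real.logb_prod _ _ (fun j _ => by positivity), Finset.prod_one_add, Finset.powerset_univ]
  congr 1
  refine Finset.sum_congr rfl fun S _ => ?_
  rw [← Real.rpow_sum_of_pos two_pos, ← Finset.sum_div, Finset.sum_neg_distrib]

/-- The bulk free energy of the XX0 model: with spin-wave energy ε(p) = −4 cos p + 2h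
and allowed momenta p^{(n)}_j = −π + 2πj/n, the free-fermion partition function
Z_n = Σ_{S ⊆ Fin n} 2^{−(Σ_{j∈S} ε(p^{(n)}_j))/T} satisfies
(1/n) log₂ Z_n → (1/(2π)) ∫_{−π}^{π} log₂(1 + 2^{−ε(p)/T}) dp. -/
theorem XX0_bulk_free_energy (T h : ℝ) (hT : 0 < T) :
    Tendsto
      (fun n : ℕ => (n : ℝ)⁻¹ *
        Real.logb 2 (∑ S : Finset (Fin n),
          (2 : ℝ) ^ (-(∑ j ∈ S, (-4 * Real.cos (-π + 2 * π * (j : ℝ) / n) + 2 * h)) / T)))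
      atTop
      (nhds ((2 * π)⁻¹ *
        ∫ p in (-π)..π, Real.logb 2 (1 + (2 : ℝ) ^ (-(-4 * Real.cos p + 2 * h) / T)))) := by
  have hcont : Continuous fun p : ℝ =>
      Real.logb 2 (1 + (2 : ℝ) ^ (-(-4 * Real.cos p + 2 * h) / T)) := by
    refine Continuous.logb ?_ fun p => by positivity
    exact continuous_const.add (Continuous.rpow (by fun_prop) (by fun_prop) fun _ =>
      Or.inl two_ne_zero)
  refine ((tendsto_left_riemann_sum (by linarith [pi_pos]) hcont.continuousOn).const_mul
    (2 * π)⁻¹).congr fun n => ?_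
  rw [logb_sum_rpow_neg_sum_div, ← mul_assoc, ← Fin.sum_univ_eq_sum_range
    (fun j : ℕ => Real.logb 2
      (1 + (2 : ℝ) ^ (-(-4 * Real.cos (-π + (π - -π) * (j : ℝ) / n) + 2 * h) / T)))]
  have hwidth : π - -π = 2 * π := by ring
  rw [hwidth, div_eq_mul_inv, inv_mul_cancel_left₀ (by positivity)]
end

section
/- Fix natural numbers n ≥ 1 and m ≤ n. Let p_1 < p_2 < ⋯ < p_m be real numbers in (−π, π] each satisfying exp(i·n·p_k) = (−1)^{m+1}. Define v : (Fin n → Bool) → ℂ by: v(b) = 0 if the support of b does not have exactly m elements; and if the support of b is {x_1 < x_2 < ⋯ < x_m} ⊆ {0,…,n−1}, then v(b) = det of the m×m matrix whose (j,k) entry is exp(i·x_j·p_k). Then Σ_b |v(b)|² = n^m. -/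
open Real

/-- The (unnormalized) XX0 Bethe wave vector with momenta p_1, …, p_m: its amplitude on
a configuration b with exactly m flipped spins at sorted positions x_1 < ⋯ < x_m is
det(exp(i x_j p_k)), and 0 on all other configurations. -/
noncomputable def betheVec (n m : ℕ) (p : Fin m → ℝ) : (Fin n → Bool) → ℂ :=
  fun b =>
    if hb : (Finset.univ.filter fun j => b j = true).card = m then
      Matrix.det (Matrix.of fun j k : Fin m =>
        Complex.exp (Complex.I *
          (((((Finset.univ.filter fun j => b j = true).orderIsoOfFin hb j : Fin n) : ℕ) : ℂ))
          * (p k : ℂ)))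
    else 0

/-- The determinant of a product of rectangular matrices, expanded multilinearly in the rows. -/
theorem Matrix.det_mul_eq_sum_prod_mul_det {R ι κ : Type*} [CommRing R] [Fintype ι] [DecidableEq ι]
    [Fintype κ] (B : Matrix ι κ R) (A : Matrix κ ι R) :
    (B * A).det = ∑ f : ι → κ, (∏ i, B i (f i)) * (A.submatrix f id).det := by
  classical
  have hrow : B * A = fun i => ∑ x, B i x • A x := by
    ext i k
    simp [Matrix.mul_apply, Finset.sum_apply]
  rw [hrow]
  refine (Matrix.detRowAlternating.toMultilinearMap.map_sum fun i x => B i x • A x).trans ?_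
  refine Finset.sum_congr rfl fun f _ => ?_
  rw [MultilinearMap.map_smul_univ, smul_eq_mul]
  rfl

/-- The **Cauchy–Binet formula**. -/
theorem Matrix.det_mul_eq_sum_det_mul_det {R κ : Type*} [CommRing R] [Fintype κ] [LinearOrder κ]
    {m : ℕ} (B : Matrix (Fin m) κ R) (A : Matrix κ (Fin m) R) :
    (B * A).det = ∑ S : Finset κ, if h : S.card = m then
      (B.submatrix id (S.orderEmbOfFin h)).det * (A.submatrix (S.orderEmbOfFin h) id).det
      else 0 := by
  rw [Matrix.det_mul_eq_sum_prod_mul_det,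
    ← Finset.sum_fiberwise Finset.univ (fun f : Fin m → κ => Finset.univ.image f)]
  refine Finset.sum_congr rfl fun S _ => ?_
  split_ifs with h
  · rw [← Matrix.det_transpose, Matrix.det_apply', Finset.sum_mul]
    symm
    refine Finset.sum_bij (fun (σ : Equiv.Perm (Fin m)) _ => S.orderEmbOfFin h ∘ σ) ?_ ?_ ?_ ?_
    · intro σ _
      simp only [Finset.mem_filter, Finset.mem_univ, true_and]
      rw [← Finset.image_image, Finset.image_univ_equiv, Finset.image_orderEmbOfFin_univ]
    · intro σ _ τ _ hστ
      ext i
      have := (S.orderEmbOfFin h).injective (congrFun hστ i)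
      rw [this]
    · intro f hf
      simp only [Finset.mem_filter, Finset.mem_univ, true_and] at hf
      have hmem : ∀ i, f i ∈ S := fun i => hf ▸ Finset.mem_image_of_mem f (Finset.mem_univ i)
      have hinj : Function.Injective f := by
        rw [← Set.injOn_univ, ← Finset.coe_univ, ← Finset.card_image_iff, hf, h, Finset.card_fin]
      have hg : Function.Injective fun i => (S.orderIsoOfFin h).symm ⟨f i, hmem i⟩ :=
        fun i j hij => hinj (congrArg Subtype.val ((S.orderIsoOfFin h).symm.injective hij))
      refine ⟨Equiv.ofBijective _ (Finite.injective_iff_bijective.mp hg), Finset.mem_univ _, ?_⟩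
      ext i
      simp [← Finset.coe_orderIsoOfFin_apply]
    · intro σ _
      have hsub : A.submatrix (S.orderEmbOfFin h ∘ σ) id =
          (A.submatrix (S.orderEmbOfFin h) id).submatrix σ id := rfl
      rw [hsub, Matrix.det_permute]
      simp only [Matrix.transpose_apply, Matrix.submatrix_apply, id, Function.comp_apply]
      ring
  · refine Finset.sum_eq_zero fun f hf => ?_
    simp only [Finset.mem_filter, Finset.mem_univ, true_and] at hf
    have hninj : ¬ Function.Injective f := fun hinj => h <| by
      rw [← hf, Finset.card_image_of_injective _ hinj, Finset.card_fin]
    simp only [Function.Injective, not_forall] at hninj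
    obtain ⟨i, j, hij, hne⟩ := hninj
    rw [Matrix.det_zero_of_row_eq hne (by ext k; simp [hij]), mul_zero]

/-- The plane waves on `n` sites with momenta `p k`. -/
noncomputable def planeWave (n m : ℕ) (p : Fin m → ℝ) : Matrix (Fin n) (Fin m) ℂ :=
  Matrix.of fun x k => Complex.exp (Complex.I * ((x : ℕ) : ℂ) * (p k : ℂ))

theorem sum_pow_eq_zero_of_pow_eq_one {K : Type*} [Field K] {z : K} {n : ℕ} (hz : z ≠ 1)
    (hzn : z ^ n = 1) : ∑ x : Fin n, z ^ (x : ℕ) = 0 := by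
  rw [Fin.sum_univ_eq_sum_range (fun x => z ^ x), geom_sum_eq hz, hzn, sub_self, zero_div]

/-- Plane waves with distinct momenta satisfying the same quantization condition are
orthogonal. -/
theorem planeWave_conjTranspose_mul_self (n m : ℕ) (p : Fin m → ℝ) (hp : Function.Injective p)
    (hrange : ∀ k, p k ∈ Set.Ioc (-π) π)
    {c : ℂ} (hquant : ∀ k, Complex.exp (Complex.I * (n : ℂ) * (p k : ℂ)) = c) :
    (planeWave n m p).conjTranspose * planeWave n m p =
      Matrix.diagonal fun _ => (n : ℂ) := by
  ext l k
  have hterm : ∀ x : Fin n, (planeWave n m p).conjTranspose l x * planeWave n m p x k =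
      Complex.exp (Complex.I * (p k - p l)) ^ (x : ℕ) := by
    intro x
    simp only [planeWave, Matrix.conjTranspose_apply, Matrix.of_apply, Complex.star_def,
      ← Complex.exp_conj, ← Complex.exp_add, ← Complex.exp_nat_mul, map_mul, Complex.conj_I,
      Complex.conj_ofReal, map_natCast]
    congr 1
    ring
  simp only [Matrix.mul_apply, hterm]
  by_cases hlk : l = k
  · subst hlk
    simp
  · rw [Matrix.diagonal_apply_ne _ hlk]
    refine sum_pow_eq_zero_of_pow_eq_one (fun hz => hlk ?_) ?_
    · rw [mul_sub, Complex.exp_sub, div_eq_one_iff_eq (Complex.exp_ne_zero _)] at hz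
      have := Complex.exp_inj_of_neg_pi_lt_of_le_pi (by simpa using (hrange k).1)
        (by simpa using (hrange k).2) (by simpa using (hrange l).1)
        (by simpa using (hrange l).2) hz
      exact (hp (Complex.ofReal_injective (mul_left_cancel₀ Complex.I_ne_zero this))).symm
    · have hexp : (n : ℂ) * (Complex.I * (p k - p l)) =
          Complex.I * n * p k - Complex.I * n * p l := by ring
      rw [← Complex.exp_nat_mul, hexp, Complex.exp_sub, hquant, ← hquant l,
        div_self (Complex.exp_ne_zero _)]

/-- Configurations correspond to their supports. -/
def configEquivFinset (n : ℕ) : (Fin n → Bool) ≃ Finset (Fin n) where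
  toFun b := Finset.univ.filter fun j => b j = true
  invFun S j := decide (j ∈ S)
  left_inv b := by ext j; simp
  right_inv S := by ext j; simp

/-- Norm of the Bethe eigenvector: for momenta p_1 < ⋯ < p_m in (−π, π] satisfying the
quantization condition exp(i n p_k) = (−1)^{m+1}, one has Σ_b |v(b)|² = n^m. -/
theorem betheVec_norm_sq (n m : ℕ) (hn : 1 ≤ n) (hm : m ≤ n)
    (p : Fin m → ℝ) (hmono : StrictMono p)
    (hrange : ∀ k, p k ∈ Set.Ioc (-π) π)
    (hquant : ∀ k, Complex.exp (Complex.I * (n : ℂ) * (p k : ℂ)) = (-1 : ℂ) ^ (m + 1)) :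
    ∑ b : Fin n → Bool, Complex.normSq (betheVec n m p b) = (n : ℝ) ^ m := by
  have hdet := congrArg Matrix.det
    (planeWave_conjTranspose_mul_self n m p hmono.injective hrange hquant)
  rw [Matrix.det_mul_eq_sum_det_mul_det, Matrix.det_diagonal, Finset.prod_const,
    Finset.card_fin, ← (configEquivFinset n).sum_comp] at hdet
  apply Complex.ofReal_injective
  push_cast
  rw [← hdet]
  refine Finset.sum_congr rfl fun b _ => ?_
  have hv : betheVec n m p b = if h : (configEquivFinset n b).card = m then
      ((planeWave n m p).submatrix ((configEquivFinset n b).orderEmbOfFin h) id).det else 0 := rfl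
  rw [hv, Complex.normSq_eq_conj_mul_self]
  split_ifs with h
  · rw [← Matrix.conjTranspose_submatrix, Matrix.det_conjTranspose]
    rfl
  · simp
end

section
/- Fix natural numbers n ≥ 1 and m ≤ n. Let p_1 < p_2 < ⋯ < p_m and q_1 < q_2 < ⋯ < q_m be real numbers in (−π, π], each satisfying exp(i·n·p_k) = (−1)^{m+1} and exp(i·n·q_k) = (−1)^{m+1}, and suppose {p_1,…,p_m} ≠ {q_1,…,q_m}. Define v, w : (Fin n → Bool) → ℂ by: v(b) = w(b) = 0 if the support of b does not have exactly m elements; and if the support of b is {x_1 < ⋯ < x_m} ⊆ {0,…,n−1}, then v(b) = det(exp(i·x_j·p_k)) and w(b) = det(exp(i·x_j·q_k)) (determinants of m×m matrices with (j,k) entries as indicated). Then Σ_b conj(v(b))·w(b) = 0. -/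
open Real

/-- Discrete plane waves on `n` sites with distinct momenta in `(-π, π]` and the same phase over a
full period are orthogonal. -/
theorem sum_conj_planeWave_mul_planeWave_eq_zero {n : ℕ} {a b : ℝ}
    (ha : a ∈ Set.Ioc (-π) π) (hb : b ∈ Set.Ioc (-π) π) (hab : a ≠ b)
    (h : Complex.exp (Complex.I * (n : ℂ) * (a : ℂ)) = Complex.exp (Complex.I * (n : ℂ) * (b : ℂ))) :
    ∑ x : Fin n, (starRingEnd ℂ) (Complex.exp (Complex.I * ((x : ℕ) : ℂ) * (a : ℂ))) *
      Complex.exp (Complex.I * ((x : ℕ) : ℂ) * (b : ℂ)) = 0 := by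
  set z : ℂ := Complex.exp (((b - a : ℝ) : ℂ) * Complex.I) with hz
  have hterm (x : ℕ) : (starRingEnd ℂ) (Complex.exp (Complex.I * (x : ℂ) * (a : ℂ))) *
      Complex.exp (Complex.I * (x : ℂ) * (b : ℂ)) = z ^ x := by
    rw [← Complex.exp_conj, ← Complex.exp_add, hz, ← Complex.exp_nat_mul]
    congr 1
    simp only [map_mul, Complex.conj_I, Complex.conj_ofReal, Complex.conj_natCast,
      Complex.ofReal_sub]
    ring
  have hzn : z ^ n = 1 := by
    have hsub : (n : ℂ) * (((b - a : ℝ) : ℂ) * Complex.I) =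
        Complex.I * (n : ℂ) * (b : ℂ) - Complex.I * (n : ℂ) * (a : ℂ) := by
      push_cast
      ring
    rw [hz, ← Complex.exp_nat_mul, hsub, Complex.exp_sub, h, div_self (Complex.exp_ne_zero _)]
  have hz1 : z ≠ 1 := by
    intro hz'
    rw [hz, Complex.exp_eq_one_iff] at hz'
    obtain ⟨k, hk⟩ := hz'
    have hk' : b - a = k * (2 * π) := by
      have : ((b - a : ℝ) : ℂ) = ((k * (2 * π) : ℝ) : ℂ) := by
        apply mul_right_cancel₀ Complex.I_ne_zero
        rw [hk]
        push_cast
        ring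
      exact_mod_cast this
    have hπ := Real.pi_pos
    have hk1 : (k : ℝ) < 1 := by
      by_contra! hc
      nlinarith [ha.1, ha.2, hb.1, hb.2]
    have hk2 : (-1 : ℝ) < k := by
      by_contra! hc
      nlinarith [ha.1, ha.2, hb.1, hb.2]
    have hk0 : k = 0 := by
      have h1 : k < 1 := by exact_mod_cast hk1
      have h2 : -1 < k := by exact_mod_cast hk2
      omega
    rw [hk0] at hk'
    apply hab
    simp at hk'
    linarith
  simp only [hterm]
  rw [Fin.sum_univ_eq_sum_range (fun x => z ^ x) n, geom_sum_eq hz1, hzn, sub_self, zero_div]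

/-- If each pair of bijections matches some orthogonal pair of columns of `A` and `B`, then the sum
over all row selections of products of minors of `A` and `B` vanishes. -/
theorem sum_det_submatrix_mul_det_submatrix_eq_zero {ι κ R : Type*} [Fintype ι] [Fintype κ]
    [DecidableEq κ] [CommRing R] (A B : Matrix ι κ R)
    (h : ∀ σ τ : Equiv.Perm κ, ∃ j, ∑ x, A x (σ j) * B x (τ j) = 0) :
    ∑ f : κ → ι, (A.submatrix f id).det * (B.submatrix f id).det = 0 := by
  have hexp (f : κ → ι) : (A.submatrix f id).det * (B.submatrix f id).det =
      ∑ σ : Equiv.Perm κ, ∑ τ : Equiv.Perm κ,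
        ((Equiv.Perm.sign σ : ℤ) : R) * ((Equiv.Perm.sign τ : ℤ) : R) *
          ∏ j, A (f j) (σ j) * B (f j) (τ j) := by
    rw [← Matrix.det_transpose (A.submatrix f id), ← Matrix.det_transpose (B.submatrix f id),
      Matrix.det_apply', Matrix.det_apply', Finset.sum_mul_sum]
    refine Finset.sum_congr rfl fun σ _ => Finset.sum_congr rfl fun τ _ => ?_
    simp only [Matrix.transpose_apply, Matrix.submatrix_apply, id, Finset.prod_mul_distrib]
    ring
  simp only [hexp]
  rw [Finset.sum_comm]
  refine Finset.sum_eq_zero fun σ _ => ?_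
  rw [Finset.sum_comm]
  refine Finset.sum_eq_zero fun τ _ => ?_
  obtain ⟨j, hj⟩ := h σ τ
  rw [← Finset.mul_sum, ← Fintype.prod_sum fun j x => A x (σ j) * B x (τ j),
    Finset.prod_eq_zero (Finset.mem_univ j) hj, mul_zero]

/-- Summing a permutation-invariant function over the enumerations of a set of `m` elements gives
`m!` times its value on the increasing enumeration. -/
theorem sum_filter_image_eq_factorial_mul {ι R : Type*} [Fintype ι] [LinearOrder ι] [CommRing R]
    {m : ℕ} (F : (Fin m → ι) → R) (hF : ∀ f (σ : Equiv.Perm (Fin m)), F (f ∘ σ) = F f)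
    (S : Finset ι) (hS : S.card = m) :
    ∑ f with Finset.univ.image f = S, F f =
      (m.factorial : R) * F (fun j => (S.orderIsoOfFin hS j : ι)) := by
  set e : Fin m → ι := fun j => (S.orderIsoOfFin hS j : ι)
  have he_inj : Function.Injective e :=
    Subtype.val_injective.comp (S.orderIsoOfFin hS).injective
  have he_surj : ∀ x ∈ S, ∃ j, e j = x := fun x hx =>
    ⟨(S.orderIsoOfFin hS).symm ⟨x, hx⟩,
      congrArg Subtype.val ((S.orderIsoOfFin hS).apply_symm_apply ⟨x, hx⟩)⟩
  have hsum : ∑ σ : Equiv.Perm (Fin m), F (e ∘ σ) = ∑ f with Finset.univ.image f = S, F f := by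
    refine Finset.sum_bij (fun σ _ => e ∘ σ) ?_ ?_ ?_ fun _ _ => rfl
    · intro σ _
      rw [Finset.mem_filter]
      refine ⟨Finset.mem_univ _, ?_⟩
      ext x
      simp only [Finset.mem_image, Finset.mem_univ, true_and, Function.comp_apply]
      constructor
      · rintro ⟨j, rfl⟩
        exact (S.orderIsoOfFin hS (σ j)).2
      · intro hx
        obtain ⟨j, hj⟩ := he_surj x hx
        exact ⟨σ.symm j, by simpa using hj⟩
    · intro σ _ τ _ hστ
      ext j : 1
      exact he_inj (congrFun hστ j)
    · intro f hf
      have himg : Finset.univ.image f = S := (Finset.mem_filter.mp hf).2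
      have hmem (j : Fin m) : f j ∈ S := himg ▸ Finset.mem_image_of_mem f (Finset.mem_univ j)
      have hf_inj : Function.Injective f := by
        rw [← Set.injOn_univ, ← Finset.coe_univ, ← Finset.card_image_iff, himg, hS,
          Finset.card_univ, Fintype.card_fin]
      choose g hg using fun j => he_surj (f j) (hmem j)
      have hg_inj : Function.Injective g := fun i j hij => hf_inj (by rw [← hg i, ← hg j, hij])
      exact ⟨Equiv.ofBijective g hg_inj.bijective_of_finite, Finset.mem_univ _, funext hg⟩
  rw [← hsum]
  simp [hF, Fintype.card_perm]

/-- Orthogonality of Bethe eigenvectors: if {p_1 < ⋯ < p_m} and {q_1 < ⋯ < q_m} are two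
different sets of solutions of the quantization condition exp(i n p) = (−1)^{m+1} in
(−π, π], then the corresponding Bethe vectors are orthogonal: Σ_b conj(v(b)) w(b) = 0. -/
theorem betheVec_orthogonal (n m : ℕ) (hn : 1 ≤ n) (hm : m ≤ n)
    (p q : Fin m → ℝ) (hpmono : StrictMono p) (hqmono : StrictMono q)
    (hprange : ∀ k, p k ∈ Set.Ioc (-π) π) (hqrange : ∀ k, q k ∈ Set.Ioc (-π) π)
    (hpquant : ∀ k, Complex.exp (Complex.I * (n : ℂ) * (p k : ℂ)) = (-1 : ℂ) ^ (m + 1))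
    (hqquant : ∀ k, Complex.exp (Complex.I * (n : ℂ) * (q k : ℂ)) = (-1 : ℂ) ^ (m + 1))
    (hne : Set.range p ≠ Set.range q) :
    ∑ b : Fin n → Bool, (starRingEnd ℂ) (betheVec n m p b) * betheVec n m q b = 0 := by
  classical
  set A : Matrix (Fin n) (Fin m) ℂ := Matrix.of fun x k =>
    (starRingEnd ℂ) (Complex.exp (Complex.I * ((x : ℕ) : ℂ) * (p k : ℂ)))
  set B : Matrix (Fin n) (Fin m) ℂ := Matrix.of fun x k =>
    Complex.exp (Complex.I * ((x : ℕ) : ℂ) * (q k : ℂ))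
  set F : (Fin m → Fin n) → ℂ := fun f => (A.submatrix f id).det * (B.submatrix f id).det with hF
  have hsymm (f : Fin m → Fin n) (σ : Equiv.Perm (Fin m)) : F (f ∘ σ) = F f := by
    have hdet (M : Matrix (Fin n) (Fin m) ℂ) : (M.submatrix (f ∘ σ) id).det =
        ((Equiv.Perm.sign σ : ℤ) : ℂ) * (M.submatrix f id).det := by
      rw [← Matrix.det_permute, Matrix.submatrix_submatrix]
      rfl
    simp only [hF, hdet]
    rw [mul_mul_mul_comm, ← Int.cast_mul, ← Units.val_mul, Int.units_mul_self]
    simp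
  have hsum : ∑ f, F f = 0 := by
    refine sum_det_submatrix_mul_det_submatrix_eq_zero A B fun σ τ => ?_
    obtain ⟨j, hj⟩ : ∃ j, p (σ j) ≠ q (τ j) := by
      by_contra! hall
      apply hne
      rw [← σ.surjective.range_comp p, ← τ.surjective.range_comp q]
      exact congrArg Set.range (funext hall)
    exact ⟨j, sum_conj_planeWave_mul_planeWave_eq_zero (hprange _) (hqrange _) hj
      ((hpquant _).trans (hqquant _).symm)⟩
  have hfiber (b : Fin n → Bool) :
      ∑ f with (fun x => decide (x ∈ Finset.univ.image f)) = b, F f =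
        (m.factorial : ℂ) * ((starRingEnd ℂ) (betheVec n m p b) * betheVec n m q b) := by
    have himg (f : Fin m → Fin n) : (fun x => decide (x ∈ Finset.univ.image f)) = b ↔
        Finset.univ.image f = Finset.univ.filter fun j => b j = true := by
      rw [funext_iff, Finset.ext_iff]
      refine forall_congr' fun x => ?_
      cases hbx : b x <;> simp [hbx]
    simp only [himg]
    by_cases hb : (Finset.univ.filter fun j => b j = true).card = m
    · rw [sum_filter_image_eq_factorial_mul F hsymm _ hb, betheVec, betheVec, dif_pos hb,
        dif_pos hb, RingHom.map_det]
      rfl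
    · rw [betheVec, dif_neg hb, map_zero, zero_mul, mul_zero]
      refine Finset.sum_eq_zero fun f hf => ?_
      have hf_not : ¬ Function.Injective f := fun hinj => hb <| by
        rw [← (Finset.mem_filter.mp hf).2, Finset.card_image_of_injective _ hinj,
          Finset.card_univ, Fintype.card_fin]
      obtain ⟨i, j, hij, hne'⟩ := Function.not_injective_iff.mp hf_not
      have hdet : (A.submatrix f id).det = 0 :=
        Matrix.det_zero_of_row_eq hne' (funext fun k => by simp [hij])
      simp only [hF, hdet, zero_mul]
  rw [← Finset.sum_fiberwise Finset.univ
    (fun (f : Fin m → Fin n) x => decide (x ∈ Finset.univ.image f)) F] at hsum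
  simp only [hfiber] at hsum
  rw [← Finset.mul_sum] at hsum
  exact (mul_eq_zero.mp hsum).resolve_left (by exact_mod_cast m.factorial_ne_zero)
end
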